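/- arXiv:2308.01767 — 2 statements merged into one kernel-verified Lean document; each statement's English description precedes it below -/
import Mathlib

section
/- Suppose every indecomposable object of T is homologically connected. Then every object G of T admits a decomposition G ≅ X₁ ⊕ ⋯ ⊕ X_l such that each X_a is homologically connected and X_a ⊕ X_b is not homologically connected whenever a ≠ b; moreover this decomposition (the hc decomposition of G) is unique up to relabelling of the summands and isomorphism. -/
/-! **Statement 0** (Lemma 3.3 of the paper): hc decompositions in a `k`-linear,
Hom-finite, Krull–Schmidt triangulated category. -/

open CategoryTheory CategoryTheory.Limits CategoryTheory.Pretriangulated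

universe v u

variable {C : Type u} [Category.{v} C] [Preadditive C] [HasZeroObject C]
  [HasShift C ℤ] [∀ m : ℤ, (shiftFunctor C m).Additive] [Pretriangulated C]
  [HasFiniteBiproducts C]

/-- `X` belongs to `⟨G⟩₁`, the smallest full subcategory containing all suspensions
`G⟦i⟧` and closed under finite direct sums and direct summands: `X` is a retract of a
finite direct sum of suspensions of `G`. -/
def InLangOne (G X : C) : Prop :=
  ∃ (m : ℕ) (f : Fin m → ℤ) (s : X ⟶ ⨁ fun j : Fin m => G⟦f j⟧)
    (r : (⨁ fun j : Fin m => G⟦f j⟧) ⟶ X), s ≫ r = 𝟙 X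

/-- There is a nonzero morphism of degree 1 (an element of `Ext¹`) from `X` to `Y`
or from `Y` to `X`. -/
def Deg1Linked (X Y : C) : Prop :=
  (∃ f : X ⟶ Y⟦(1 : ℤ)⟧, f ≠ 0) ∨ (∃ f : Y ⟶ X⟦(1 : ℤ)⟧, f ≠ 0)

/-- `G` is homologically connected: any two indecomposable objects of `⟨G⟩₁` are joined
by a finite zig-zag of indecomposable objects of `⟨G⟩₁` with nonzero degree-1 morphisms
(in one direction or the other) between consecutive terms. -/
def HomConnected (G : C) : Prop :=
  ∀ F F' : C, Indecomposable F → Indecomposable F' → InLangOne G F → InLangOne G F' →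
    Relation.ReflTransGen
      (fun X Y => Indecomposable X ∧ Indecomposable Y ∧ InLangOne G X ∧ InLangOne G Y ∧
        Deg1Linked X Y) F F'

/-! ### Preliminaries on preadditive categories -/

section Preadditive

variable {D : Type u} [Category.{v} D] [Preadditive D]

/-- If the identity of an object with local endomorphism ring is a finite sum of morphisms
factoring through objects `Y i`, then the object is a retract of some `Y i`. -/
lemma exists_retract_of_id_eq_sum {ι : Type*} [Fintype ι] {X : D} [IsLocalRing (End X)]
    {Y : ι → D} (f : ∀ i, X ⟶ Y i) (g : ∀ i, Y i ⟶ X) (h : 𝟙 X = ∑ i, f i ≫ g i) :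
    ∃ i, Nonempty (Retract X (Y i)) := by
  have hu : IsUnit (∑ i, End.of (f i ≫ g i)) := by
    have : ∑ i, End.of (f i ≫ g i) = 1 := h.symm
    rw [this]
    exact isUnit_one
  obtain ⟨i, -, hi⟩ := IsLocalRing.exists_of_isUnit_sum hu
  have : IsIso (f i ≫ g i) := (isUnit_iff_isIso _).1 hi
  exact ⟨i, ⟨⟨f i, g i ≫ inv (f i ≫ g i), by rw [← Category.assoc, IsIso.hom_inv_id]⟩⟩⟩

lemma isLocalRing_end_of_iso {X Y : D} (e : X ≅ Y) [IsLocalRing (End X)] :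
    IsLocalRing (End Y) where
  toNontrivial := e.conj.symm.toEquiv.nontrivial
  isUnit_or_isUnit_of_add_one {a b} hab := by
    have h : e.symm.conj a + e.symm.conj b = 1 := by
      have : e.hom ≫ (a + b) ≫ e.inv = 𝟙 X := by
        rw [hab, End.one_def]; simp
      rw [Preadditive.add_comp, Preadditive.comp_add] at this
      exact this
    exact (IsLocalRing.isUnit_or_isUnit_of_add_one h).imp
      (MulEquiv.isUnit_map e.symm.conj).1 (MulEquiv.isUnit_map e.symm.conj).1

lemma indecomposable_of_isLocalRing_end [HasBinaryBiproducts D] (X : D) [IsLocalRing (End X)] :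
    Indecomposable X := by
  refine ⟨fun h => one_ne_zero (α := End X) (h.eq_of_src _ _), fun Y Z e => ?_⟩
  have hsum : End.of (e.hom ≫ (biprod.fst ≫ biprod.inl) ≫ e.inv) +
      End.of (e.hom ≫ (biprod.snd ≫ biprod.inr) ≫ e.inv) = 1 := by
    have : e.hom ≫ (biprod.fst ≫ biprod.inl + biprod.snd ≫ biprod.inr) ≫ e.inv = 𝟙 X := by
      rw [biprod.total]; simp
    rw [Preadditive.add_comp, Preadditive.comp_add] at this
    exact this
  rcases IsLocalRing.isUnit_or_isUnit_of_add_one hsum with h | h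
  · right
    have : IsIso (e.hom ≫ (biprod.fst ≫ biprod.inl) ≫ e.inv) := (isUnit_iff_isIso _).1 h
    have h0 : (biprod.inr ≫ e.inv : Z ⟶ X) = 0 := by
      rw [← cancel_mono (e.hom ≫ (biprod.fst ≫ biprod.inl) ≫ e.inv)]
      simp
    rw [IsZero.iff_id_eq_zero]
    calc 𝟙 Z = (biprod.inr ≫ e.inv) ≫ e.hom ≫ biprod.snd := by simp
      _ = 0 := by rw [h0, zero_comp]
  · left
    have : IsIso (e.hom ≫ (biprod.snd ≫ biprod.inr) ≫ e.inv) := (isUnit_iff_isIso _).1 h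
    have h0 : (biprod.inl ≫ e.inv : Y ⟶ X) = 0 := by
      rw [← cancel_mono (e.hom ≫ (biprod.snd ≫ biprod.inr) ≫ e.inv)]
      simp
    rw [IsZero.iff_id_eq_zero]
    calc 𝟙 Y = (biprod.inl ≫ e.inv) ≫ e.hom ≫ biprod.fst := by simp
      _ = 0 := by rw [h0, zero_comp]

/-- The left summand as a retract of a binary biproduct. -/
noncomputable def biprod.retractLeft (A B : D) [HasBinaryBiproduct A B] : Retract A (A ⊞ B) where
  i := biprod.inl
  r := biprod.fst

/-- The right summand as a retract of a binary biproduct. -/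
noncomputable def biprod.retractRight (A B : D) [HasBinaryBiproduct A B] : Retract B (A ⊞ B) where
  i := biprod.inr
  r := biprod.snd

variable [HasFiniteBiproducts D]

lemma biproduct.exists_not_isZero {ι : Type} [Finite ι] {X : D} {f : ι → D} (e : X ≅ ⨁ f)
    (hX : ¬ IsZero X) : ∃ j, ¬ IsZero (f j) := by
  by_contra! h
  refine hX (IsZero.of_iso ?_ e)
  rw [IsZero.iff_id_eq_zero]
  exact biproduct.hom_ext _ _ fun j => (h j).eq_of_tgt _ _

/-- Summands are retracts. -/
noncomputable def biproduct.retract {ι : Type} [Finite ι] {X : D} {f : ι → D} (e : X ≅ ⨁ f) (j : ι) :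
    Retract (f j) X where
  i := biproduct.ι f j ≫ e.inv
  r := e.hom ≫ biproduct.π f j

lemma biproduct.id_eq_sum {ι : Type} [Fintype ι] {X : D} {f : ι → D} (e : X ≅ ⨁ f) :
    𝟙 X = ∑ j, (e.hom ≫ biproduct.π f j) ≫ (biproduct.ι f j ≫ e.inv) := by
  have : e.hom ≫ (∑ j, biproduct.π f j ≫ biproduct.ι f j) ≫ e.inv = 𝟙 X := by
    rw [biproduct.total]; simp
  simpa only [Preadditive.sum_comp, Preadditive.comp_sum, Category.assoc] using this.symm

/-- Group the summands of a biproduct along a map of index types. -/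
noncomputable def biproduct.fiberIso {ι κ : Type} [Finite ι] [Finite κ] (c : ι → κ) (F : ι → D) :
    (⨁ fun a : κ => ⨁ fun i : {i // c i = a} => F i) ≅ ⨁ F :=
  biproductBiproductIso (fun a : κ => {i // c i = a}) (fun _ i => F i) ≪≫
    biproduct.whiskerEquiv (Equiv.sigmaFiberEquiv c) (fun _ => Iso.refl _)

end Preadditive

/-- In a pretriangulated category, a nonzero retract of an indecomposable object is
isomorphic to it. -/
lemma CategoryTheory.Indecomposable.nonempty_iso_of_retract {X Y : C} (hY : Indecomposable Y)
    (h : Retract X Y) (hX : ¬ IsZero X) : Nonempty (X ≅ Y) := by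
  obtain ⟨Z, g, δ, hT⟩ := distinguished_cocone_triangle h.i
  have hmono : Mono h.i := h.splitMono.mono
  obtain ⟨e, he, -⟩ := exists_iso_binaryBiproduct_of_distTriang _ hT
    (Triangle.mor₃_eq_zero_of_mono₁ _ hT hmono)
  have hZ : IsZero Z := (hY.2 _ _ e).resolve_left hX
  exact ⟨isoBiprodZero hZ ≪≫ e.symm⟩

lemma CategoryTheory.Indecomposable.shift {X : C} (hX : Indecomposable X) (n : ℤ) : Indecomposable (X⟦n⟧) := by
  have key : ∀ {Y : C} (m : ℤ), IsZero (Y⟦m⟧) → IsZero Y := fun {Y} m h =>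
    ((shiftFunctor C (-m)).map_isZero h).of_iso (shiftShiftNeg Y m).symm
  refine ⟨fun h => hX.1 (key n h), fun Y Z e => ?_⟩
  have := preservesBinaryBiproducts_of_preservesBiproducts (shiftFunctor C (-n))
  exact (hX.2 (Y⟦-n⟧) (Z⟦-n⟧) ((shiftShiftNeg X n).symm ≪≫ (shiftFunctor C (-n)).mapIso e ≪≫
    (shiftFunctor C (-n)).mapBiprod Y Z)).imp (key _) (key _)

/-! ### Krull–Schmidt categories -/

variable (C) in
/-- Every object is a finite direct sum of objects with local endomorphism ring. -/
def IsKrullSchmidt : Prop :=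
  ∀ X : C, ∃ (m : ℕ) (f : Fin m → C), (∀ j, IsLocalRing (End (f j))) ∧ Nonempty (X ≅ ⨁ f)

lemma IsKrullSchmidt.isLocalRing_end (hC : IsKrullSchmidt C) {X : C} (hX : Indecomposable X) :
    IsLocalRing (End X) := by
  obtain ⟨m, f, hf, ⟨e⟩⟩ := hC X
  obtain ⟨j, hj⟩ := biproduct.exists_not_isZero e hX.1
  obtain ⟨e'⟩ := hX.nonempty_iso_of_retract (biproduct.retract e j) hj
  have := hf j
  exact isLocalRing_end_of_iso e'

/-! ### Indecomposable objects of `⟨G⟩₁` -/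

lemma InLangOne.of_retract_shift {G X : C} {n : ℤ} (h : Retract X (G⟦n⟧)) : InLangOne G X :=
  ⟨1, fun _ => n, h.i ≫ biproduct.ι (fun _ : Fin 1 => G⟦n⟧) 0,
    biproduct.π (fun _ : Fin 1 => G⟦n⟧) 0 ≫ h.r, by simp⟩

lemma InLangOne.of_retract {G X : C} (h : Retract X G) : InLangOne G X :=
  .of_retract_shift (n := 0) (h.trans (Retract.ofIso (shiftZero ℤ G).symm))

lemma InLangOne.refl (G : C) : InLangOne G G :=
  .of_retract (Retract.refl G)

lemma InLangOne.exists_retract_shift (hC : IsKrullSchmidt C) {G X : C} (h : InLangOne G X)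
    (hX : Indecomposable X) : ∃ n : ℤ, Nonempty (Retract X (G⟦n⟧)) := by
  obtain ⟨m, f, s, r, hsr⟩ := h
  have := hC.isLocalRing_end hX
  obtain ⟨j, hj⟩ := exists_retract_of_id_eq_sum (X := X)
    (fun j => s ≫ biproduct.π (fun j : Fin m => G⟦f j⟧) j)
    (fun j => biproduct.ι (fun j : Fin m => G⟦f j⟧) j ≫ r) (by
      have : s ≫ (∑ j, biproduct.π (fun j : Fin m => G⟦f j⟧) j ≫
          biproduct.ι (fun j : Fin m => G⟦f j⟧) j) ≫ r = 𝟙 X := by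
        rw [biproduct.total]; simpa using hsr
      simpa only [Preadditive.sum_comp, Preadditive.comp_sum, Category.assoc] using this.symm)
  exact ⟨f j, hj⟩

lemma InLangOne.trans (hC : IsKrullSchmidt C) {G X Y : C} (hGX : InLangOne G X)
    (hX : Indecomposable X) (hXY : InLangOne X Y) (hY : Indecomposable Y) : InLangOne G Y := by
  obtain ⟨n, ⟨h⟩⟩ := hGX.exists_retract_shift hC hX
  obtain ⟨m, ⟨h'⟩⟩ := hXY.exists_retract_shift hC hY
  exact .of_retract_shift ((h'.trans (h.map (shiftFunctor C m))).trans
    (Retract.ofIso (shiftAdd G n m).symm))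

lemma InLangOne.of_retract_left (hC : IsKrullSchmidt C) {A B X : C} (h : InLangOne A X)
    (hX : Indecomposable X) (hAB : Retract A B) : InLangOne B X := by
  obtain ⟨n, ⟨h⟩⟩ := h.exists_retract_shift hC hX
  exact .of_retract_shift (h.trans (hAB.map (shiftFunctor C n)))

lemma InLangOne.shift (hC : IsKrullSchmidt C) {G X : C} (h : InLangOne G X)
    (hX : Indecomposable X) (n : ℤ) : InLangOne G (X⟦n⟧) :=
  h.trans hC hX (.of_retract_shift (Retract.refl _)) (hX.shift n)

/-- An indecomposable object of `⟨A⟩₁`, where `A` is a direct summand of the sum of the `Y i`,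
lies in some `⟨Y i⟩₁`. -/
lemma InLangOne.exists_of_id_eq_sum (hC : IsKrullSchmidt C) {ι : Type*} [Fintype ι] {A X : C}
    (h : InLangOne A X) (hX : Indecomposable X) {Y : ι → C} (p : ∀ i, A ⟶ Y i) (q : ∀ i, Y i ⟶ A)
    (hpq : 𝟙 A = ∑ i, p i ≫ q i) : ∃ i, InLangOne (Y i) X := by
  obtain ⟨n, ⟨h⟩⟩ := h.exists_retract_shift hC hX
  have := hC.isLocalRing_end hX
  obtain ⟨i, ⟨hi⟩⟩ := exists_retract_of_id_eq_sum (X := X)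
    (fun i => h.i ≫ (p i)⟦n⟧') (fun i => (q i)⟦n⟧' ≫ h.r) (by
      have : h.i ≫ (shiftFunctor C n).map (∑ i, p i ≫ q i) ≫ h.r = 𝟙 X := by
        rw [← hpq]; simp
      simpa [Functor.map_sum, Preadditive.sum_comp, Preadditive.comp_sum] using this.symm)
  exact ⟨i, .of_retract_shift hi⟩

lemma InLangOne.exists_of_iso_biproduct (hC : IsKrullSchmidt C) {ι : Type} [Finite ι] {A X : C}
    (h : InLangOne A X) (hX : Indecomposable X) {Y : ι → C} (e : A ≅ ⨁ Y) :
    ∃ i, InLangOne (Y i) X := by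
  have := Fintype.ofFinite ι
  exact h.exists_of_id_eq_sum hC hX _ _ (biproduct.id_eq_sum e)

lemma InLangOne.or_of_biprod (hC : IsKrullSchmidt C) {A B X : C}
    (h : InLangOne (A ⊞ B) X) (hX : Indecomposable X) : InLangOne A X ∨ InLangOne B X := by
  obtain ⟨i, hi⟩ := h.exists_of_id_eq_sum hC hX (Y := fun i : Bool => cond i A B)
    (fun i => match i with | true => biprod.fst | false => biprod.snd)
    (fun i => match i with | true => biprod.inl | false => biprod.inr)
    (by simp [biprod.total])
  cases i
  exacts [.inr hi, .inl hi]

lemma exists_indecomposable_inLangOne (hC : IsKrullSchmidt C) {A : C} (hA : ¬ IsZero A) :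
    ∃ F, Indecomposable F ∧ InLangOne A F := by
  obtain ⟨m, f, hf, ⟨e⟩⟩ := hC A
  obtain ⟨j, -⟩ := biproduct.exists_not_isZero e hA
  have := hf j
  exact ⟨f j, indecomposable_of_isLocalRing_end _, .of_retract (biproduct.retract e j)⟩

lemma exists_deg1Linked_of_ne_zero (hC : IsKrullSchmidt C) {A B : C} {f : A ⟶ B} (hf : f ≠ 0) :
    ∃ F F', Indecomposable F ∧ Indecomposable F' ∧ InLangOne A F ∧ InLangOne B F' ∧
      Deg1Linked F F' := by
  obtain ⟨m, P, hP, ⟨e⟩⟩ := hC A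
  obtain ⟨n, Q, hQ, ⟨e'⟩⟩ := hC B
  obtain ⟨i, j, hij⟩ : ∃ i j, biproduct.ι P i ≫ e.inv ≫ f ≫ e'.hom ≫ biproduct.π Q j ≠ 0 := by
    by_contra! h
    refine hf ?_
    rw [← cancel_epi e.inv, ← cancel_mono e'.hom]
    refine biproduct.hom_ext' _ _ fun i => biproduct.hom_ext _ _ fun j => ?_
    simpa using h i j
  have := hP i
  have := hQ j
  have hQj := indecomposable_of_isLocalRing_end (Q j)
  refine ⟨P i, (Q j)⟦(-1 : ℤ)⟧, indecomposable_of_isLocalRing_end _, hQj.shift _,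
    .of_retract (biproduct.retract e i),
    (InLangOne.of_retract (biproduct.retract e' j)).shift hC hQj _,
    .inl ⟨(biproduct.ι P i ≫ e.inv ≫ f ≫ e'.hom ≫ biproduct.π Q j) ≫
      (shiftNegShift (Q j) (1 : ℤ)).inv, fun h => hij ?_⟩⟩
  rwa [← cancel_mono (shiftNegShift (Q j) (1 : ℤ)).inv, zero_comp]

/-! ### Chains of degree-1 morphisms -/

/-- `X` and `Y` are indecomposable objects of `⟨G⟩₁` with a nonzero degree-1 morphism between
them. -/
def LangLink (G X Y : C) : Prop :=
  Indecomposable X ∧ Indecomposable Y ∧ InLangOne G X ∧ InLangOne G Y ∧ Deg1Linked X Y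

lemma LangLink.symm {G X Y : C} (h : LangLink G X Y) : LangLink G Y X :=
  ⟨h.2.1, h.1, h.2.2.2.1, h.2.2.1, h.2.2.2.2.symm⟩

/-- `X` and `Y` are joined by a zig-zag of degree-1 morphisms in `⟨G⟩₁`. -/
def LangConnected (G : C) : C → C → Prop :=
  Relation.ReflTransGen (LangLink G)

lemma LangConnected.trans {G X Y Z : C} (h : LangConnected G X Y) (h' : LangConnected G Y Z) :
    LangConnected G X Z :=
  Relation.ReflTransGen.trans h h'

lemma LangConnected.symm {G X Y : C} (h : LangConnected G X Y) : LangConnected G Y X :=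
  have : Std.Symm (LangLink G) := ⟨fun _ _ => LangLink.symm⟩
  symm_of (Relation.ReflTransGen (LangLink G)) h

lemma LangConnected.mono {A B X Y : C} (hAB : ∀ F, Indecomposable F → InLangOne A F → InLangOne B F)
    (h : LangConnected A X Y) : LangConnected B X Y :=
  Relation.ReflTransGen.mono
    (fun _ _ h => ⟨h.1, h.2.1, hAB _ h.1 h.2.2.1, hAB _ h.2.1 h.2.2.2.1, h.2.2.2.2⟩) _ _ h

lemma HomConnected.langConnected_of_retract (hC : IsKrullSchmidt C) {A B F F' : C}
    (hA : HomConnected A) (hAB : Retract A B) (hF : Indecomposable F) (hF' : Indecomposable F')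
    (hAF : InLangOne A F) (hAF' : InLangOne A F') : LangConnected B F F' :=
  LangConnected.mono (fun _ h h' => h'.of_retract_left hC h hAB) (hA F F' hF hF' hAF hAF')

lemma HomConnected.biprod (hC : IsKrullSchmidt C) {A B F F' : C}
    (hA : HomConnected A) (hB : HomConnected B) (hF : Indecomposable F) (hF' : Indecomposable F')
    (hAF : InLangOne A F) (hBF' : InLangOne B F') (h : LangConnected (A ⊞ B) F F') :
    HomConnected (A ⊞ B) := by
  have key : ∀ H, Indecomposable H → InLangOne (A ⊞ B) H → LangConnected (A ⊞ B) H F := by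
    intro H hH hABH
    rcases hABH.or_of_biprod hC hH with hAH | hBH
    · exact hA.langConnected_of_retract hC (biprod.retractLeft _ _) hH hF hAH hAF
    · exact (hB.langConnected_of_retract hC (biprod.retractRight _ _) hH hF' hBH
        hBF').trans h.symm
  exact fun H H' hH hH' h₁ h₂ => (key H hH h₁).trans (key H' hH' h₂).symm

/-! ### Decompositions into homologically connected summands -/

/-- The data of an hc decomposition `G ≅ ⨁ X` into nonzero summands. -/
structure IsHCDecomposition (G : C) {l : ℕ} (X : Fin l → C) : Prop where
  nonempty_iso : Nonempty (G ≅ ⨁ X)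
  not_isZero : ∀ a, ¬ IsZero (X a)
  homConnected : ∀ a, HomConnected (X a)
  not_homConnected_biprod : ∀ a b, a ≠ b → ¬ HomConnected (X a ⊞ X b)

namespace IsHCDecomposition

variable {G : C} {l : ℕ} {X : Fin l → C}

lemma eq_of_langConnected_biprod (h : IsHCDecomposition G X) (hC : IsKrullSchmidt C)
    {a b : Fin l} {F F' : C} (hF : Indecomposable F) (hF' : Indecomposable F')
    (ha : InLangOne (X a) F) (hb : InLangOne (X b) F')
    (hFF' : LangConnected (X a ⊞ X b) F F') : a = b := by
  by_contra hab
  exact h.not_homConnected_biprod a b hab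
    ((h.homConnected a).biprod hC (h.homConnected b) hF hF' ha hb hFF')

lemma eq_of_inLangOne (h : IsHCDecomposition G X) (hC : IsKrullSchmidt C)
    {a b : Fin l} {F : C} (hF : Indecomposable F)
    (ha : InLangOne (X a) F) (hb : InLangOne (X b) F) : a = b :=
  h.eq_of_langConnected_biprod hC hF hF ha hb .refl

lemma inLangOne_of_langLink (h : IsHCDecomposition G X) (hC : IsKrullSchmidt C)
    {a : Fin l} {F F' : C} (hFF' : LangLink G F F') (ha : InLangOne (X a) F) :
    InLangOne (X a) F' := by
  obtain ⟨hF, hF', -, hGF', hlink⟩ := hFF'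
  obtain ⟨e⟩ := h.nonempty_iso
  obtain ⟨b, hb⟩ := hGF'.exists_of_iso_biproduct hC hF' e
  have : a = b := h.eq_of_langConnected_biprod hC hF hF' ha hb <| .single
    ⟨hF, hF', ha.of_retract_left hC hF (biprod.retractLeft _ _),
      hb.of_retract_left hC hF' (biprod.retractRight _ _), hlink⟩
  exact this ▸ hb

lemma inLangOne_of_langConnected (h : IsHCDecomposition G X) (hC : IsKrullSchmidt C)
    {a : Fin l} {F F' : C} (hFF' : LangConnected G F F') (ha : InLangOne (X a) F) :
    InLangOne (X a) F' := by
  induction hFF' with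
  | refl => exact ha
  | tail _ hlink ih => exact h.inLangOne_of_langLink hC hlink ih

lemma inLangOne (h : IsHCDecomposition G X) (hC : IsKrullSchmidt C)
    {a : Fin l} {F : C} (hF : Indecomposable F) (ha : InLangOne (X a) F) : InLangOne G F := by
  obtain ⟨e⟩ := h.nonempty_iso
  exact ha.of_retract_left hC hF (biproduct.retract e a)

lemma langConnected (h : IsHCDecomposition G X) (hC : IsKrullSchmidt C)
    {a : Fin l} {F F' : C} (hF : Indecomposable F) (hF' : Indecomposable F')
    (ha : InLangOne (X a) F) (ha' : InLangOne (X a) F') : LangConnected G F F' := by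
  obtain ⟨e⟩ := h.nonempty_iso
  exact (h.homConnected a).langConnected_of_retract hC (biproduct.retract e a) hF hF' ha ha'

variable {l' : ℕ} {X' : Fin l' → C}

/-- Summands of two hc decompositions of `G` whose subcategories `⟨-⟩₁` share an indecomposable
object have the same indecomposable objects in `⟨-⟩₁`. -/
lemma inLangOne_of_common (h : IsHCDecomposition G X) (h' : IsHCDecomposition G X')
    (hC : IsKrullSchmidt C) {a : Fin l} {b : Fin l'} {F H : C} (hF : Indecomposable F)
    (hH : Indecomposable H) (ha : InLangOne (X a) F) (hb : InLangOne (X' b) F)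
    (haH : InLangOne (X a) H) : InLangOne (X' b) H :=
  h'.inLangOne_of_langConnected hC (h.langConnected hC hF hH ha haH) hb

/-- A nonzero morphism between summands of two hc decompositions of `G` forces them to share an
indecomposable object. -/
lemma exists_common_of_ne_zero (h : IsHCDecomposition G X) (h' : IsHCDecomposition G X')
    (hC : IsKrullSchmidt C) {a : Fin l} {b : Fin l'} {f : X a ⟶ X' b} (hf : f ≠ 0) :
    ∃ F, Indecomposable F ∧ InLangOne (X a) F ∧ InLangOne (X' b) F := by
  obtain ⟨F, F', hF, hF', ha, hb, hlink⟩ := exists_deg1Linked_of_ne_zero hC hf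
  exact ⟨F', hF', h.inLangOne_of_langLink hC
    ⟨hF, hF', h.inLangOne hC hF ha, h'.inLangOne hC hF' hb, hlink⟩ ha, hb⟩

lemma exists_common (h : IsHCDecomposition G X) (h' : IsHCDecomposition G X')
    (hC : IsKrullSchmidt C) (a : Fin l) :
    ∃ b F, Indecomposable F ∧ InLangOne (X a) F ∧ InLangOne (X' b) F := by
  obtain ⟨F, hF, ha⟩ := exists_indecomposable_inLangOne hC (h.not_isZero a)
  obtain ⟨e⟩ := h'.nonempty_iso
  obtain ⟨b, hb⟩ := (h.inLangOne hC hF ha).exists_of_iso_biproduct hC hF e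
  exact ⟨b, F, hF, ha, hb⟩

lemma eq_of_common (h : IsHCDecomposition G X) (h' : IsHCDecomposition G X')
    (hC : IsKrullSchmidt C) {a : Fin l} {b c : Fin l'}
    (hb : ∃ F, Indecomposable F ∧ InLangOne (X a) F ∧ InLangOne (X' b) F)
    (hc : ∃ F, Indecomposable F ∧ InLangOne (X a) F ∧ InLangOne (X' c) F) : b = c := by
  obtain ⟨F, hF, haF, hbF⟩ := hb
  obtain ⟨H, hH, haH, hcH⟩ := hc
  exact h'.eq_of_inLangOne hC hF hbF (h.inLangOne_of_common h' hC hH hF haH hcH haF)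

/-- The component of an isomorphism between two hc decompositions at summands which share an
indecomposable object has a right inverse. -/
lemma component_comp (h : IsHCDecomposition G X) (h' : IsHCDecomposition G X')
    (hC : IsKrullSchmidt C) (e : (⨁ X) ≅ ⨁ X') {a : Fin l} {b : Fin l'}
    (hab : ∃ F, Indecomposable F ∧ InLangOne (X a) F ∧ InLangOne (X' b) F) :
    (biproduct.ι X a ≫ e.hom ≫ biproduct.π X' b) ≫
      (biproduct.ι X' b ≫ e.inv ≫ biproduct.π X a) = 𝟙 (X a) := by
  have hsum : biproduct.ι X a ≫ e.hom ≫ (∑ c, biproduct.π X' c ≫ biproduct.ι X' c) ≫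
      e.inv ≫ biproduct.π X a = 𝟙 (X a) := by
    rw [biproduct.total]; simp
  simp only [Preadditive.sum_comp, Preadditive.comp_sum] at hsum
  rw [Finset.sum_eq_single b] at hsum
  · simpa using hsum
  · intro c _ hcb
    have hzero : biproduct.ι X a ≫ e.hom ≫ biproduct.π X' c = 0 := by
      by_contra hne
      exact hcb (h.eq_of_common h' hC (h.exists_common_of_ne_zero h' hC hne) hab)
    simpa using hzero =≫ (biproduct.ι X' c ≫ e.inv ≫ biproduct.π X a)
  · simp

/-- Uniqueness of the hc decomposition. -/
lemma exists_equiv (h : IsHCDecomposition G X) (h' : IsHCDecomposition G X')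
    (hC : IsKrullSchmidt C) : ∃ σ : Fin l ≃ Fin l', ∀ a, Nonempty (X a ≅ X' (σ a)) := by
  have swap : ∀ {a b}, (∃ F, Indecomposable F ∧ InLangOne (X a) F ∧ InLangOne (X' b) F) →
      ∃ F, Indecomposable F ∧ InLangOne (X' b) F ∧ InLangOne (X a) F :=
    fun ⟨F, hF, h₁, h₂⟩ => ⟨F, hF, h₂, h₁⟩
  choose σ hσ using h.exists_common h' hC
  choose τ hτ using h'.exists_common h hC
  refine ⟨⟨σ, τ, fun a => h'.eq_of_common h hC (hτ _) (swap (hσ a)),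
    fun b => h.eq_of_common h' hC (hσ _) (by
      obtain ⟨F, hF, h₁, h₂⟩ := hτ b
      exact ⟨F, hF, h₂, h₁⟩)⟩, fun a => ?_⟩
  obtain ⟨e⟩ := h.nonempty_iso
  obtain ⟨e'⟩ := h'.nonempty_iso
  exact ⟨⟨_, _, h.component_comp h' hC (e.symm ≪≫ e') (hσ a),
    h'.component_comp h hC (e.symm ≪≫ e').symm (swap (hσ a))⟩⟩

end IsHCDecomposition

/-- Existence of the hc decomposition. -/
lemma exists_isHCDecomposition (hC : IsKrullSchmidt C)
    (hind : ∀ X : C, Indecomposable X → HomConnected X) (G : C) :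
    ∃ (l : ℕ) (X : Fin l → C), IsHCDecomposition G X := by
  classical
  obtain ⟨m, F, hloc, ⟨e⟩⟩ := hC G
  have hF (i) : Indecomposable (F i) :=
    have := hloc i
    indecomposable_of_isLocalRing_end _
  let s : Setoid (Fin m) :=
    ⟨fun i j => LangConnected G (F i) (F j), fun _ => .refl, .symm, .trans⟩
  let q := Fintype.equivFin (Quotient s)
  let c : Fin m → Fin (Fintype.card (Quotient s)) := fun i => q ⟦i⟧
  have hc {i j} : c i = c j ↔ LangConnected G (F i) (F j) :=
    q.injective.eq_iff.trans Quotient.eq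
  let X : Fin (Fintype.card (Quotient s)) → C := fun a => ⨁ fun i : {i // c i = a} => F i
  let eX : G ≅ ⨁ X := e ≪≫ (biproduct.fiberIso c F).symm
  have hXF (i) : InLangOne (X (c i)) (F i) :=
    .of_retract (biproduct.retract (Iso.refl (X (c i))) ⟨i, rfl⟩)
  have hFG {i H} (hH : Indecomposable H) (hi : InLangOne (F i) H) : LangConnected G (F i) H :=
    (hind _ (hF i)).langConnected_of_retract hC (biproduct.retract e i) (hF i) hH (.refl _) hi
  have hXG {a H} (hH : Indecomposable H) (ha : InLangOne (X a) H) : InLangOne G H :=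
    ha.of_retract_left hC hH (biproduct.retract eX a)
  have hXc {a H} (hH : Indecomposable H) (ha : InLangOne (X a) H) :
      ∃ i, c i = a ∧ LangConnected G (F i) H := by
    obtain ⟨⟨i, hi⟩, hiH⟩ := ha.exists_of_iso_biproduct hC hH (Iso.refl (X a))
    exact ⟨i, hi, hFG hH hiH⟩
  have hclosed {a H K} (hHK : LangLink G H K) (ha : InLangOne (X a) H) : InLangOne (X a) K := by
    obtain ⟨hH, hK, -, hGK, -⟩ := id hHK
    obtain ⟨i, rfl, hi⟩ := hXc hH ha
    obtain ⟨j, hj⟩ := hGK.exists_of_iso_biproduct hC hK e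
    have hij : c i = c j := hc.2 ((hi.trans (.single hHK)).trans (hFG hK hj).symm)
    rw [hij]
    exact (hXF j).trans hC (hF j) hj hK
  refine ⟨_, X, ⟨eX⟩, fun a => ?_, fun a H H' hH hH' ha ha' => ?_, fun a b hab hhc => ?_⟩
  · obtain ⟨x, rfl⟩ := q.surjective a
    obtain ⟨i, rfl⟩ := Quotient.exists_rep x
    exact fun h0 => (hF i).1 <| (IsZero.iff_id_eq_zero _).2 <| by
      rw [← (biproduct.retract (Iso.refl (X (c i))) ⟨i, rfl⟩).retract, h0.eq_of_tgt
        (biproduct.retract (Iso.refl (X (c i))) ⟨i, rfl⟩).i 0, zero_comp]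
  · obtain ⟨i, hi, hiH⟩ := hXc hH ha
    obtain ⟨j, hj, hjH'⟩ := hXc hH' ha'
    have hHH' : LangConnected G H H' :=
      (hiH.symm.trans (hc.1 (hi.trans hj.symm))).trans hjH'
    clear hH hH' ha' hiH hjH' hi hj
    induction hHH' using Relation.ReflTransGen.head_induction_on with
    | refl => exact .refl
    | head hlink _ ih =>
      have hK := hclosed hlink ha
      exact .head ⟨hlink.1, hlink.2.1, ha, hK, hlink.2.2.2.2⟩ (ih hK)
  · obtain ⟨x, rfl⟩ := q.surjective a
    obtain ⟨i, rfl⟩ := Quotient.exists_rep x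
    obtain ⟨y, rfl⟩ := q.surjective b
    obtain ⟨j, rfl⟩ := Quotient.exists_rep y
    refine hab (hc.2 (LangConnected.mono (fun H hH h => ?_) (hhc (F i) (F j) (hF i) (hF j)
      ((hXF i).of_retract_left hC (hF i) (biprod.retractLeft _ _))
      ((hXF j).of_retract_left hC (hF j) (biprod.retractRight _ _)))))
    exact (h.or_of_biprod hC hH).elim (hXG hH) (hXG hH)

/-- Lemma 3.3: let `k` be a field and `C` a `k`-linear, Hom-finite,
Krull–Schmidt triangulated category in which every indecomposable object is
homologically connected. Then every object `G` admits a decomposition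
`G ≅ X₁ ⊕ ⋯ ⊕ X_l` into nonzero homologically connected summands such that
`X_a ⊕ X_b` is not homologically connected whenever `a ≠ b`; moreover this
hc decomposition is unique up to relabelling of the summands and isomorphism. -/
theorem hc_decomposition (k : Type*) [Field k] [Linear k C]
    (hfin : ∀ X Y : C, FiniteDimensional k (X ⟶ Y))
    (hKS : ∀ X : C, ∃ (m : ℕ) (f : Fin m → C),
      (∀ j, IsLocalRing (End (f j))) ∧ Nonempty (X ≅ ⨁ f))
    (hind : ∀ X : C, Indecomposable X → HomConnected X)
    (G : C) :
    ∃ (l : ℕ) (X : Fin l → C),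
      Nonempty (G ≅ ⨁ X) ∧
      (∀ a, ¬ IsZero (X a)) ∧
      (∀ a, HomConnected (X a)) ∧
      (∀ a b, a ≠ b → ¬ HomConnected (X a ⊞ X b)) ∧
      (∀ (l' : ℕ) (X' : Fin l' → C), Nonempty (G ≅ ⨁ X') →
        (∀ a, ¬ IsZero (X' a)) →
        (∀ a, HomConnected (X' a)) →
        (∀ a b, a ≠ b → ¬ HomConnected (X' a ⊞ X' b)) →
        ∃ σ : Fin l ≃ Fin l', ∀ a, Nonempty (X a ≅ X' (σ a))) := by
  obtain ⟨l, X, h⟩ := exists_isHCDecomposition hKS hind G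
  exact ⟨l, X, h.nonempty_iso, h.not_isZero, h.homConnected, h.not_homConnected_biprod,
    fun l' X' h₁ h₂ h₃ h₄ => h.exists_equiv ⟨h₁, h₂, h₃, h₄⟩ hKS⟩
end

section
/- For every n ≥ 1, the cardinality of eNNC_{2n} is given by |eNNC_{2n}| = Σ_{j=0}^{n} (−1)^j · binom(n,j) · |NNC_{2n−j}|. -/
/-! Non-exhaustive non-crossing partitions. For `m ≥ 1` we write `[m] = {1, …, m}`,
realised as `Set.Icc 1 m ⊆ ℕ`. -/

/-- `P` is a non-exhaustive non-crossing partition of `[m]`: a collection of pairwise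
disjoint nonempty subsets of `[m]` (blocks) such that whenever `i < k < j < l` with
`i, j` in a block `B` and `k, l` in a block `B'`, then `B = B'`. -/
def IsNNC (m : ℕ) (P : Set (Set ℕ)) : Prop :=
  (∀ B ∈ P, B.Nonempty ∧ B ⊆ Set.Icc 1 m) ∧
  (∀ B ∈ P, ∀ B' ∈ P, B ≠ B' → Disjoint B B') ∧
  (∀ B ∈ P, ∀ B' ∈ P, ∀ i k j l : ℕ, i < k → k < j → j < l →
    i ∈ B → j ∈ B → k ∈ B' → l ∈ B' → B = B')

/-- `P` is an even-exclusive non-exhaustive non-crossing partition of `[m]`: an element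
of `NNC_m` having no singleton block `{i}` with `i` even. -/
def IsENNC (m : ℕ) (P : Set (Set ℕ)) : Prop :=
  IsNNC m P ∧ ∀ i : ℕ, Even i → ({i} : Set ℕ) ∉ P

/-- `P` refines `Q`: every block of `P` is contained in some block of `Q`. -/
def Refines (P Q : Set (Set ℕ)) : Prop :=
  ∀ B ∈ P, ∃ B' ∈ Q, B ⊆ B'

/-- Non-exhaustive non-crossing partitions of an arbitrary set `U` of natural numbers. -/
def IsNNCOn (U : Set ℕ) (P : Set (Set ℕ)) : Prop :=
  (∀ B ∈ P, B.Nonempty ∧ B ⊆ U) ∧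
  (∀ B ∈ P, ∀ B' ∈ P, B ≠ B' → Disjoint B B') ∧
  (∀ B ∈ P, ∀ B' ∈ P, ∀ i k j l : ℕ, i < k → k < j → j < l →
    i ∈ B → j ∈ B → k ∈ B' → l ∈ B' → B = B')

theorem isNNC_iff_isNNCOn {m : ℕ} {P : Set (Set ℕ)} :
    IsNNC m P ↔ IsNNCOn (Finset.Icc 1 m : Finset ℕ) P := by
  rw [Finset.coe_Icc]
  rfl

theorem finite_setOf_isNNCOn {U : Set ℕ} (hU : U.Finite) : {P | IsNNCOn U P}.Finite :=
  hU.finite_subsets.finite_subsets.subset fun _ hP B hB => (hP.1 B hB).2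

theorem IsNNCOn.image {A B : Set ℕ} {f : ℕ → ℕ} (hf : StrictMonoOn f A) (hAB : Set.MapsTo f A B)
    {P : Set (Set ℕ)} (hP : IsNNCOn A P) : IsNNCOn B (Set.image f '' P) := by
  obtain ⟨h1, h2, h3⟩ := hP
  refine ⟨?_, ?_, ?_⟩
  · rintro _ ⟨C, hC, rfl⟩
    exact ⟨(h1 C hC).1.image f, (hAB.mono_left (h1 C hC).2).image_subset⟩
  · rintro _ ⟨C, hC, rfl⟩ _ ⟨D, hD, rfl⟩ hne
    have hCD : Disjoint C D := h2 C hC D hD fun h => hne (h ▸ rfl)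
    exact hCD.image hf.injOn (h1 C hC).2 (h1 D hD).2
  · rintro _ ⟨C, hC, rfl⟩ _ ⟨D, hD, rfl⟩ _ _ _ _ hik hkj hjl
      ⟨i, hi, rfl⟩ ⟨j, hj, rfl⟩ ⟨k, hk, rfl⟩ ⟨l, hl, rfl⟩
    have hCA := (h1 C hC).2
    have hDA := (h1 D hD).2
    rw [hf.lt_iff_lt (hCA hi) (hDA hk)] at hik
    rw [hf.lt_iff_lt (hDA hk) (hCA hj)] at hkj
    rw [hf.lt_iff_lt (hCA hj) (hDA hl)] at hjl
    rw [h3 C hC D hD i k j l hik hkj hjl hi hj hk hl]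

theorem Finset.exists_strictMonoOn_mapsTo_of_card_eq {A B : Finset ℕ} (h : A.card = B.card) :
    ∃ f : ℕ → ℕ, StrictMonoOn f A ∧ Set.MapsTo f A B := by
  let e := (A.orderIsoOfFin h).symm.trans (B.orderIsoOfFin rfl)
  have he {x : ℕ} (hx : x ∈ A) : (if hx : x ∈ A then (e ⟨x, hx⟩ : ℕ) else 0) = e ⟨x, hx⟩ :=
    dif_pos hx
  refine ⟨fun x => if hx : x ∈ A then e ⟨x, hx⟩ else 0, fun x hx y hy hxy => ?_, fun x hx => ?_⟩
  · beta_reduce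
    rw [he hx, he hy]
    exact e.strictMono hxy
  · beta_reduce
    rw [he hx]
    exact (e ⟨x, hx⟩).2

theorem ncard_isNNCOn_le_of_card_eq {A B : Finset ℕ} (h : A.card = B.card) :
    {P | IsNNCOn A P}.ncard ≤ {P | IsNNCOn B P}.ncard := by
  obtain ⟨f, hf, hAB⟩ := Finset.exists_strictMonoOn_mapsTo_of_card_eq h
  refine Set.ncard_le_ncard_of_injOn (Set.image (Set.image f))
    (fun P hP => hP.image hf hAB) (fun P hP Q hQ hPQ => ?_)
    (finite_setOf_isNNCOn B.finite_toSet)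
  have hinj : Set.InjOn (Set.image f) (𝒫 (A : Set ℕ)) := hf.injOn.image
  exact hinj.image (fun C hC => (hP.1 C hC).2) (fun C hC => (hQ.1 C hC).2) hPQ

theorem ncard_isNNCOn_eq_of_card_eq {A B : Finset ℕ} (h : A.card = B.card) :
    {P | IsNNCOn A P}.ncard = {P | IsNNCOn B P}.ncard :=
  (ncard_isNNCOn_le_of_card_eq h).antisymm (ncard_isNNCOn_le_of_card_eq h.symm)

theorem ncard_isNNCOn (U : Finset ℕ) :
    {P | IsNNCOn U P}.ncard = Nat.card {P : Set (Set ℕ) // IsNNC U.card P} := by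
  simp_rw [isNNC_iff_isNNCOn]
  rw [ncard_isNNCOn_eq_of_card_eq (B := Finset.Icc 1 U.card) (by simp)]
  exact (Nat.card_coe_set_eq _).symm

theorem IsNNCOn.mono {U V : Set ℕ} (hUV : U ⊆ V) {P : Set (Set ℕ)} (hP : IsNNCOn U P) :
    IsNNCOn V P :=
  ⟨fun B hB => ⟨(hP.1 B hB).1, (hP.1 B hB).2.trans hUV⟩, hP.2⟩

theorem IsNNCOn.subset {U : Set ℕ} {P Q : Set (Set ℕ)} (hQP : Q ⊆ P) (hP : IsNNCOn U P) :
    IsNNCOn U Q :=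
  ⟨fun B hB => hP.1 B (hQP hB), fun B hB C hC => hP.2.1 B (hQP hB) C (hQP hC),
    fun B hB C hC => hP.2.2 B (hQP hB) C (hQP hC)⟩

theorem IsNNCOn.insert_singleton {U : Set ℕ} {t : ℕ} (ht : t ∈ U) {P : Set (Set ℕ)}
    (hP : IsNNCOn (U \ {t}) P) : IsNNCOn U (insert {t} P) := by
  have ht' {B : Set ℕ} (hB : B ∈ P) : t ∉ B := fun h => ((hP.1 B hB).2 h).2 rfl
  have hPU := hP.mono Set.sdiff_subset
  refine ⟨?_, ?_, ?_⟩
  · rintro B (rfl | hB)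
    · simpa using ht
    · exact hPU.1 B hB
  · rintro B (rfl | hB) C (rfl | hC) hne
    · exact absurd rfl hne
    · exact Set.disjoint_singleton_left.2 (ht' hC)
    · exact Set.disjoint_singleton_right.2 (ht' hB)
    · exact hP.2.1 B hB C hC hne
  · rintro B (rfl | hB) C (rfl | hC) i k j l hik hkj hjl hi hj hk hl
    · rfl
    · rw [Set.mem_singleton_iff] at hi hj
      omega
    · rw [Set.mem_singleton_iff] at hk hl
      omega
    · exact hP.2.2 B hB C hC i k j l hik hkj hjl hi hj hk hl

theorem IsNNCOn.diff_singleton {U : Set ℕ} {t : ℕ} {P : Set (Set ℕ)} (hP : IsNNCOn U P)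
    (ht : {t} ∈ P) : IsNNCOn (U \ {t}) (P \ {{t}}) := by
  refine ⟨fun B hB => ⟨(hP.1 B hB.1).1, Set.subset_sdiff.2 ⟨(hP.1 B hB.1).2, ?_⟩⟩,
    (hP.subset Set.sdiff_subset).2⟩
  exact hP.2.1 B hB.1 _ ht hB.2

/-- The partitions in `NNC` of `U` none of whose blocks is `{i}` with `i ∈ T`. -/
def nncAvoiding (U T : Set ℕ) : Set (Set (Set ℕ)) :=
  {P | IsNNCOn U P ∧ ∀ i ∈ T, {i} ∉ P}

theorem finite_nncAvoiding {U : Set ℕ} (hU : U.Finite) (T : Set ℕ) : (nncAvoiding U T).Finite :=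
  (finite_setOf_isNNCOn hU).subset fun _ hP => hP.1

theorem singleton_notMem_of_mem_nncAvoiding_diff {U T : Set ℕ} {t : ℕ} {P : Set (Set ℕ)}
    (hP : P ∈ nncAvoiding (U \ {t}) T) : {t} ∉ P :=
  fun h => ((hP.1.1 _ h).2 rfl).2 rfl

theorem nncAvoiding_eq_union {U T : Set ℕ} {t : ℕ} (htU : t ∈ U) (htT : t ∉ T) :
    nncAvoiding U T =
      nncAvoiding U (insert t T) ∪ insert {t} '' nncAvoiding (U \ {t}) T := by
  ext P
  constructor
  · rintro ⟨hP, hT⟩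
    by_cases ht : {t} ∈ P
    · exact Or.inr ⟨P \ {{t}}, ⟨hP.diff_singleton ht, fun i hi h => hT i hi h.1⟩,
        Set.insert_sdiff_self_of_mem ht⟩
    · exact Or.inl ⟨hP, Set.forall_mem_insert.2 ⟨ht, hT⟩⟩
  · rintro (⟨hP, hT⟩ | ⟨Q, ⟨hQ, hT⟩, rfl⟩)
    · exact ⟨hP, fun i hi => hT i (Set.mem_insert_of_mem t hi)⟩
    · refine ⟨hQ.insert_singleton htU, fun i hi h => ?_⟩
      rcases h with h | h
      · exact htT (Set.singleton_injective h ▸ hi)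
      · exact hT i hi h

theorem ncard_nncAvoiding_insert {U T : Set ℕ} (hU : U.Finite) {t : ℕ} (htU : t ∈ U)
    (htT : t ∉ T) :
    (nncAvoiding U T).ncard =
      (nncAvoiding U (insert t T)).ncard + (nncAvoiding (U \ {t}) T).ncard := by
  rw [nncAvoiding_eq_union htU htT, Set.ncard_union_eq ?_ (finite_nncAvoiding hU _)
    ((finite_nncAvoiding hU.sdiff _).image _), Set.InjOn.ncard_image]
  · intro P hP Q hQ hPQ
    have := congrArg (· \ {{t}}) hPQ
    simpa [Set.insert_sdiff_of_mem, singleton_notMem_of_mem_nncAvoiding_diff hP,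
      singleton_notMem_of_mem_nncAvoiding_diff hQ] using this
  · rw [Set.disjoint_left]
    rintro _ hP ⟨Q, -, rfl⟩
    exact hP.2 t (Set.mem_insert t T) (Set.mem_insert _ _)

theorem ncard_nncAvoiding (U T : Finset ℕ) (hTU : T ⊆ U) :
    ((nncAvoiding U T).ncard : ℤ) = ∑ S ∈ T.powerset,
      (-1 : ℤ) ^ S.card * Nat.card {P : Set (Set ℕ) // IsNNC (U.card - S.card) P} := by
  induction T using Finset.induction_on generalizing U with
  | empty => simp [nncAvoiding, ncard_isNNCOn]
  | insert t T ht ih =>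
    obtain ⟨htU, hTU⟩ := Finset.insert_subset_iff.1 hTU
    have key := ncard_nncAvoiding_insert U.finite_toSet (T := T) (t := t) htU ht
    rw [← Finset.coe_insert, ← Finset.coe_erase] at key
    have hdiff : ((nncAvoiding U (insert t T : Finset ℕ)).ncard : ℤ) =
        (nncAvoiding U T).ncard - (nncAvoiding (U.erase t : Finset ℕ) T).ncard := by
      rw [key]
      push_cast
      ring
    rw [hdiff, ih U hTU, ih (U.erase t) (Finset.subset_erase.2 ⟨hTU, ht⟩),
      Finset.sum_powerset_insert ht, sub_eq_add_neg, ← Finset.sum_neg_distrib]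
    congr 1
    refine Finset.sum_congr rfl fun S hS => ?_
    rw [Finset.card_insert_of_notMem fun h => ht (Finset.mem_powerset.1 hS h),
      Finset.card_erase_of_mem htU, Nat.sub_sub, add_comm 1, pow_succ]
    ring

theorem isENNC_iff_mem_nncAvoiding {n : ℕ} {P : Set (Set ℕ)} :
    IsENNC (2 * n) P ↔ P ∈ nncAvoiding (Finset.Icc 1 (2 * n) : Finset ℕ)
      ((Finset.Icc 1 n).image (2 * ·) : Finset ℕ) := by
  rw [IsENNC, isNNC_iff_isNNCOn]
  refine and_congr_right fun hP => ⟨fun h i hi => h i ?_, fun h i hi hiP => h i ?_ hiP⟩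
  · obtain ⟨k, -, rfl⟩ := Finset.mem_image.1 hi
    exact even_two_mul k
  · obtain ⟨k, rfl⟩ := hi.two_dvd
    have := Finset.mem_Icc.1 ((hP.1 _ hiP).2 rfl)
    exact Finset.mem_image.2 ⟨k, Finset.mem_Icc.2 (by omega), rfl⟩

/-- Lemma 4.16 of the paper: for every `n ≥ 1`,
`|eNNC_{2n}| = ∑_{j=0}^{n} (-1)^j ⬝ binom(n,j) ⬝ |NNC_{2n-j}|`. -/
theorem card_eNNC (n : ℕ) (hn : 1 ≤ n) :
    (Nat.card {P : Set (Set ℕ) // IsENNC (2 * n) P} : ℤ) =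
      ∑ j ∈ Finset.range (n + 1),
        (-1 : ℤ) ^ j * (n.choose j) * (Nat.card {P : Set (Set ℕ) // IsNNC (2 * n - j) P}) := by
  simp_rw [isENNC_iff_mem_nncAvoiding]
  have hsub : (Finset.Icc 1 n).image (2 * ·) ⊆ Finset.Icc 1 (2 * n) := by
    intro i hi
    simp only [Finset.mem_image, Finset.mem_Icc] at hi ⊢
    omega
  have hcard : ((Finset.Icc 1 n).image (2 * ·)).card = n := by
    rw [Finset.card_image_of_injective _ (mul_right_injective₀ two_ne_zero)]
    simp
  have key := ncard_nncAvoiding _ _ hsub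
  rw [Finset.sum_powerset_apply_card (fun j =>
    (-1 : ℤ) ^ j * Nat.card {P : Set (Set ℕ) // IsNNC ((Finset.Icc 1 (2 * n)).card - j) P}),
    hcard, Nat.card_Icc, Nat.add_sub_cancel] at key
  refine key.trans (Finset.sum_congr rfl fun j _ => ?_)
  rw [nsmul_eq_mul]
  ring
end
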